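/- arXiv:2503.05013 — 9 statements merged into one kernel-verified Lean document; each statement's English description precedes it below -/
import Mathlib

section
/- For every non-negative integer n, (n+1)*(2n+1)*S(2n,1) = (-1)^n * binom(3n,n) * binom(2n,n) * (2n^2+n+1); equivalently, S(2n,1) = (-1)^n * C3(n) * Cat(n) * (2n^2+n+1), where C3(n) = binom(3n,n)/(2n+1) is the Fuss-Catalan number of order three and Cat(n) = binom(2n,n)/(n+1) is the Catalan number. -/
/-- Catalan triangle number `C(N,k) = binom(N+k,N) - binom(N+k,N+1)`. -/
def catT (N k : ℕ) : ℤ := ((N + k).choose N : ℤ) - ((N + k).choose (N + 1) : ℤ)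

/-- `S(2n,m) = Σ_{k=0}^{2n} (-1)^k binom(2n,k)^m C(2n,k) C(2n,2n-k)`. -/
def S (n m : ℕ) : ℤ :=
  ∑ k ∈ Finset.range (2 * n + 1),
    (-1) ^ k * ((2 * n).choose k : ℤ) ^ m * catT (2 * n) k * catT (2 * n) (2 * n - k)

open Nat in
/-- The reciprocal factorial on the integers, vanishing at negative arguments. -/
def invFactorial (z : ℤ) : ℚ := if z < 0 then 0 else ((z.toNat)! : ℚ)⁻¹

open Nat in
/-- The factorial on the integers, with value `1` at negative arguments. -/
def intFactorial (z : ℤ) : ℚ := ((z.toNat)! : ℚ)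

open Nat in
theorem invFactorial_natCast (n : ℕ) : invFactorial n = (n ! : ℚ)⁻¹ := by
  simp [invFactorial]

open Nat in
theorem intFactorial_natCast (n : ℕ) : intFactorial n = (n ! : ℚ) := by
  simp [intFactorial]

theorem invFactorial_of_neg {z : ℤ} (hz : z < 0) : invFactorial z = 0 := by
  simp [invFactorial, hz]

theorem mul_invFactorial (z : ℤ) : (z : ℚ) * invFactorial z = invFactorial (z - 1) := by
  rcases lt_trichotomy z 0 with hz | rfl | hz
  · rw [invFactorial_of_neg hz, invFactorial_of_neg (by lia), mul_zero]
  · rw [invFactorial_of_neg (z := 0 - 1) (by lia), Int.cast_zero, zero_mul]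
  · obtain ⟨n, rfl⟩ : ∃ n : ℕ, z = (n + 1 : ℕ) := ⟨(z - 1).toNat, by lia⟩
    rw [show ((n + 1 : ℕ) : ℤ) - 1 = (n : ℤ) by push_cast; ring, invFactorial_natCast,
      invFactorial_natCast, Nat.factorial_succ]
    have := Nat.factorial_ne_zero n
    push_cast
    field_simp

theorem intFactorial_eq_mul {z : ℤ} (hz : 0 < z) :
    intFactorial z = z * intFactorial (z - 1) := by
  obtain ⟨n, rfl⟩ : ∃ n : ℕ, z = (n + 1 : ℕ) := ⟨(z - 1).toNat, by lia⟩
  rw [show ((n + 1 : ℕ) : ℤ) - 1 = (n : ℤ) by push_cast; ring, intFactorial_natCast,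
    intFactorial_natCast, Nat.factorial_succ]
  push_cast
  ring

/-- The unsigned summand of the terminating well-poised (Dixon) sum. -/
def dixonTerm (a b m j : ℤ) : ℚ :=
  intFactorial (m + j) * intFactorial (m - j) * invFactorial (a + j) * invFactorial (a - j) *
    invFactorial (b + j) * invFactorial (b - j)

/-- The Gosper-type antidifference certifying the recurrence of the Dixon sum. -/
def dixonCert (a b m j : ℤ) : ℚ :=
  intFactorial (m + j) * intFactorial (m + 1 - j) * invFactorial (a + j - 1) *
    invFactorial (a - j) * invFactorial (b + j) * invFactorial (b + 1 - j) / 2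

theorem mul_dixonTerm (a b m j : ℤ) :
    ((b : ℚ) ^ 2 - j ^ 2) * dixonTerm a b m j = dixonTerm a (b - 1) m j := by
  have h₁ := mul_invFactorial (b + j)
  have h₂ := mul_invFactorial (b - j)
  push_cast at h₁ h₂
  rw [dixonTerm, dixonTerm, show b - 1 + j = b + j - 1 by ring,
    show b - 1 - j = b - j - 1 by ring, ← h₁, ← h₂]
  ring

theorem dixonTerm_recurrence {a b m j : ℤ} (h₁ : 0 < m + 1 + j) (h₂ : 0 < m + 1 - j) :
    ((b : ℚ) + 1) * (a + b + 1) * (m - b) * dixonTerm a (b + 1) m j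
      - (m - a - b) * dixonTerm a b m j
      = dixonCert a b m j + dixonCert a b m (j + 1) := by
  have e₀ := mul_dixonTerm a (b + 1) m j
  rw [add_sub_cancel_right] at e₀
  rw [← e₀]
  have e₁ := intFactorial_eq_mul h₁
  have e₂ := intFactorial_eq_mul h₂
  have e₃ := mul_invFactorial (a + j)
  have e₄ := mul_invFactorial (a - j)
  have e₅ := mul_invFactorial (b + 1 + j)
  have e₆ := mul_invFactorial (b + 1 - j)
  rw [show m + 1 + j - 1 = m + j by ring] at e₁
  rw [show m + 1 - j - 1 = m - j by ring] at e₂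
  rw [show b + 1 + j - 1 = b + j by ring] at e₅
  rw [show b + 1 - j - 1 = b - j by ring] at e₆
  push_cast at *
  rw [dixonTerm, dixonCert, dixonCert, show m + (j + 1) = m + 1 + j by ring,
    show m + 1 - (j + 1) = m - j by ring, show a + (j + 1) - 1 = a + j by ring,
    show a - (j + 1) = a - j - 1 by ring, show b + (j + 1) = b + 1 + j by ring,
    show b + 1 - (j + 1) = b - j by ring, e₁, e₂, ← e₃, ← e₄, ← e₅, ← e₆]
  ring

/-- The terminating well-poised (Dixon) sum, over `j = k - a` with `0 ≤ k ≤ 2a`. -/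
def dixonSum (a b m : ℕ) : ℚ :=
  ∑ k ∈ Finset.range (2 * a + 1), (-1) ^ k * dixonTerm a b m ((k : ℤ) - a)

theorem dixonSum_zero (a m : ℕ) :
    dixonSum a 0 m = (-1) ^ a *
      (intFactorial m * intFactorial m * invFactorial a * invFactorial a) := by
  rw [dixonSum, Finset.sum_eq_single a]
  · have : invFactorial 0 = 1 := by simpa using invFactorial_natCast 0
    simp [dixonTerm, this]
  · intro k _ hk
    rcases lt_or_gt_of_ne hk with h | h
    · rw [dixonTerm, invFactorial_of_neg (z := ((0 : ℕ) : ℤ) + _) (by lia)]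
      ring
    · rw [dixonTerm, invFactorial_of_neg (z := ((0 : ℕ) : ℤ) - _) (by lia)]
      ring
  · intro h
    exact absurd (Finset.mem_range.2 (by lia)) h

theorem dixonSum_succ {a m : ℕ} (b : ℕ) (ham : a ≤ m) :
    ((b : ℚ) + 1) * (a + b + 1) * (m - b) * dixonSum a (b + 1) m
      = (m - a - b) * dixonSum a b m := by
  have key : ∀ k ∈ Finset.range (2 * a + 1),
      ((b : ℚ) + 1) * (a + b + 1) * (m - b) *
          ((-1) ^ k * dixonTerm a ((b + 1 : ℕ) : ℤ) m ((k : ℤ) - a))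
        - (m - a - b) * ((-1) ^ k * dixonTerm a b m ((k : ℤ) - a))
      = -((-1) ^ (k + 1) * dixonCert a b m (((k + 1 : ℕ) : ℤ) - a))
        - -((-1) ^ k * dixonCert a b m ((k : ℤ) - a)) := by
    intro k hk
    rw [Finset.mem_range] at hk
    have h := dixonTerm_recurrence (a := a) (b := b) (m := m) (j := (k : ℤ) - a)
      (by lia) (by lia)
    rw [show (((k + 1 : ℕ) : ℤ) - a) = (k : ℤ) - a + 1 by push_cast; ring]
    push_cast at h ⊢
    linear_combination (-1) ^ k * h
  have hsum := Finset.sum_congr rfl key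
  rw [Finset.sum_range_sub (fun k : ℕ => -((-1) ^ k * dixonCert a b m ((k : ℤ) - a))),
    Finset.sum_sub_distrib, ← Finset.mul_sum, ← Finset.mul_sum] at hsum
  have left_end : dixonCert a b m (((0 : ℕ) : ℤ) - a) = 0 := by
    rw [dixonCert, invFactorial_of_neg (z := (a : ℤ) + _ - 1) (by lia)]
    ring
  have right_end : dixonCert a b m (((2 * a + 1 : ℕ) : ℤ) - a) = 0 := by
    rw [dixonCert, invFactorial_of_neg (z := (a : ℤ) - _) (by lia)]
    ring
  rw [left_end, right_end] at hsum
  simp only [mul_zero, neg_zero, sub_zero] at hsum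
  exact sub_eq_zero.1 hsum

/-- Dixon's summation theorem in terminating form. -/
theorem dixonSum_eq {a b m : ℕ} (ham : a ≤ m) (hbm : b ≤ m) :
    dixonSum a b m = (-1) ^ a *
      (intFactorial m * intFactorial ((m : ℤ) - a) * intFactorial ((m : ℤ) - b) *
        invFactorial a * invFactorial b * invFactorial ((a : ℤ) + b) *
        invFactorial ((m : ℤ) - a - b)) := by
  induction b with
  | zero =>
    have h₀ : invFactorial 0 = 1 := by simpa using invFactorial_natCast 0
    have h₁ : intFactorial ((m : ℤ) - a) * invFactorial ((m : ℤ) - a) = 1 := by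
      rw [← Nat.cast_sub ham, intFactorial_natCast, invFactorial_natCast]
      exact mul_inv_cancel₀ (by exact_mod_cast Nat.factorial_ne_zero _)
    rw [dixonSum_zero]
    simp only [Nat.cast_zero, sub_zero, add_zero, h₀]
    linear_combination -(-1) ^ a * intFactorial m * intFactorial m * invFactorial a *
      invFactorial a * h₁
  | succ b ih =>
    have hrec := dixonSum_succ b ham
    rw [ih (by lia)] at hrec
    have e₁ := intFactorial_eq_mul (z := (m : ℤ) - b) (by lia)
    have e₂ := mul_invFactorial ((b : ℤ) + 1)
    have e₃ := mul_invFactorial ((a : ℤ) + b + 1)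
    have e₄ := mul_invFactorial ((m : ℤ) - a - b)
    rw [add_sub_cancel_right] at e₂ e₃
    have hmb : (m : ℚ) - b ≠ 0 := by
      rw [sub_ne_zero]
      exact_mod_cast (by lia : m ≠ b)
    have hb : (b : ℚ) + 1 ≠ 0 := by positivity
    have hab : (a : ℚ) + b + 1 ≠ 0 := by positivity
    apply mul_left_cancel₀ (mul_ne_zero (mul_ne_zero hb hab) hmb)
    rw [hrec]
    push_cast at *
    rw [show (m : ℤ) - (b + 1) = m - b - 1 by ring, ← add_assoc (a : ℤ),
      show (m : ℤ) - a - (b + 1) = m - a - b - 1 by ring, e₁, ← e₂, ← e₃, ← e₄]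
    ring

theorem succ_mul_catT (N k : ℕ) :
    ((N : ℤ) + 1) * catT N k = (N - k + 1) * ((N + k).choose N : ℤ) := by
  have h := Nat.choose_succ_right_eq (N + k) N
  rw [Nat.add_sub_cancel_left] at h
  zify at h
  rw [catT]
  linear_combination -h

open Nat in
/-- The summand of `S n 1` as a combination of Dixon summands. -/
theorem summand_eq_dixonTerm (n k : ℕ) (hk : k ≤ 2 * n) :
    (2 * (n : ℚ) + 1) ^ 2 * ((2 * n)! : ℚ) *
        (((2 * n).choose k : ℚ) * catT (2 * n) k * catT (2 * n) (2 * n - k))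
      = (2 * n + 1) * dixonTerm n n (3 * n : ℕ) ((k : ℤ) - n)
        + dixonTerm n (n - 1) (3 * n : ℕ) ((k : ℤ) - n) := by
  obtain ⟨l, hl⟩ := Nat.exists_eq_add_of_le hk
  rw [← mul_dixonTerm]
  have hkl : 2 * n - k = l := by lia
  have hn : 2 * (n : ℚ) = k + l := by exact_mod_cast hl
  have c₁ : (2 * (n : ℚ) + 1) * catT (2 * n) k
      = (2 * n - k + 1) * ((2 * n + k).choose (2 * n) : ℚ) := by
    exact_mod_cast succ_mul_catT (2 * n) k
  have c₂ : (2 * (n : ℚ) + 1) * catT (2 * n) l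
      = (2 * n - l + 1) * ((2 * n + l).choose (2 * n) : ℚ) := by
    exact_mod_cast succ_mul_catT (2 * n) l
  have c₃ : ((2 * n).choose k : ℚ) = (2 * n)! / (k ! * l !) := by
    rw [hl, Nat.cast_add_choose]
  rw [Nat.cast_add_choose] at c₁ c₂
  have hterm : dixonTerm n n (3 * n : ℕ) ((k : ℤ) - n)
      = (2 * n + k)! * (2 * n + l)! * (k ! : ℚ)⁻¹ * (l ! : ℚ)⁻¹ * (k ! : ℚ)⁻¹ * (l ! : ℚ)⁻¹ := by
    rw [dixonTerm, show ((3 * n : ℕ) : ℤ) + (k - n) = (2 * n + k : ℕ) by push_cast; ring,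
      show ((3 * n : ℕ) : ℤ) - (k - n) = (2 * n + l : ℕ) by lia,
      show (n : ℤ) + (k - n) = k by ring, show (n : ℤ) - (k - n) = l by lia]
    simp only [intFactorial_natCast, invFactorial_natCast]
  rw [hkl, hterm]
  have hk₀ : (k ! : ℚ) ≠ 0 := by exact_mod_cast Nat.factorial_ne_zero k
  have hl₀ : (l ! : ℚ) ≠ 0 := by exact_mod_cast Nat.factorial_ne_zero l
  have hn₀ : ((2 * n)! : ℚ) ≠ 0 := by exact_mod_cast Nat.factorial_ne_zero (2 * n)
  calc _ = ((2 * n)! : ℚ) * ((2 * n).choose k : ℚ) * ((2 * (n : ℚ) + 1) * catT (2 * n) k) *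
          ((2 * (n : ℚ) + 1) * catT (2 * n) l) := by ring
    _ = _ := by
      rw [c₁, c₂, c₃]
      push_cast
      field_simp
      have : (l : ℚ) = 2 * n - k := by linear_combination -hn
      rw [this]
      ring

open Nat in
theorem mul_S_one_eq_dixonSum (n : ℕ) :
    (2 * ((n + 1 : ℕ) : ℚ) + 1) ^ 2 * ((2 * (n + 1))! : ℚ) * S (n + 1) 1
      = (2 * ((n + 1 : ℕ) : ℚ) + 1) * dixonSum (n + 1) (n + 1) (3 * (n + 1))
        + dixonSum (n + 1) n (3 * (n + 1)) := by
  rw [S, dixonSum, dixonSum, Int.cast_sum, Finset.mul_sum, Finset.mul_sum,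
    ← Finset.sum_add_distrib]
  refine Finset.sum_congr rfl fun k hk => ?_
  have h := summand_eq_dixonTerm (n + 1) k (by rw [Finset.mem_range] at hk; lia)
  rw [show ((n + 1 : ℕ) : ℤ) - 1 = n by push_cast; ring] at h
  rw [Int.cast_mul, Int.cast_mul, Int.cast_mul, pow_one, Int.cast_natCast, Int.cast_pow,
    Int.cast_neg, Int.cast_one]
  linear_combination (-1) ^ k * h

theorem stmt0 (n : ℕ) :
    ((n : ℤ) + 1) * (2 * n + 1) * S n 1 =
      (-1) ^ n * ((3 * n).choose n : ℤ) * ((2 * n).choose n : ℤ)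
        * (2 * (n : ℤ) ^ 2 + n + 1) := by
  rcases n with _ | n
  · simp [S, catT]
  have h := mul_S_one_eq_dixonSum n
  rw [dixonSum_eq (by lia) (by lia), dixonSum_eq (by lia) (by lia),
    show ((3 * (n + 1) : ℕ) : ℤ) - (n + 1 : ℕ) = (2 * n + 2 : ℕ) by push_cast; ring,
    show ((2 * n + 2 : ℕ) : ℤ) - (n + 1 : ℕ) = (n + 1 : ℕ) by push_cast; ring,
    show ((3 * (n + 1) : ℕ) : ℤ) - n = (2 * n + 2 + 1 : ℕ) by push_cast; ring,
    show ((2 * n + 2 : ℕ) : ℤ) - n = (n + 1 + 1 : ℕ) by push_cast; ring,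
    show ((n + 1 : ℕ) : ℤ) + (n + 1 : ℕ) = (2 * n + 1 + 1 : ℕ) by push_cast; ring,
    show ((n + 1 : ℕ) : ℤ) + n = (2 * n + 1 : ℕ) by push_cast; ring] at h
  simp only [intFactorial_natCast, invFactorial_natCast] at h
  have c₁ := Nat.cast_add_choose ℚ (a := n + 1) (b := 2 * n + 2)
  have c₂ := Nat.cast_add_choose ℚ (a := n + 1) (b := n + 1)
  rw [show n + 1 + (2 * n + 2) = 3 * (n + 1) by ring] at c₁
  rw [show n + 1 + (n + 1) = 2 * (n + 1) by ring] at c₂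
  qify
  rw [c₁, c₂]
  simp only [show 2 * (n + 1) = 2 * n + 1 + 1 by ring, Nat.factorial_succ (2 * n + 1 + 1),
    Nat.factorial_succ (2 * n + 1), Nat.factorial_succ (n + 1), Nat.factorial_succ n] at h ⊢
  push_cast at h ⊢
  generalize (S (n + 1) 1 : ℚ) = s at h ⊢
  field_simp at h ⊢
  have h2n₃ : (2 * (n : ℚ) + 3) ≠ 0 := by positivity
  apply mul_left_cancel₀ h2n₃
  linear_combination h
end

section
/- For every non-negative integer n and every natural number m ≥ 1, the central binomial coefficient binom(2n,n) divides S(2n,m). -/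
/-- The symmetric binomial product `binom(k,l) * binom(m,l)`; for fixed `k + m = N` these span a ring
of functions of `k`. -/
def symChoose (k m l : ℕ) : ℤ := (k.choose l : ℤ) * (m.choose l : ℤ)

/-- The structure constants of the ring spanned by the functions `symChoose`. -/
def symCoeff (N i j l : ℕ) : ℤ :=
  if l ≤ i + j then ((N - l).choose (i + j - l) : ℤ) * (l.choose i : ℤ) * (l.choose j : ℤ) else 0

theorem succ_mul_choose_succ_int (k l : ℕ) :
    ((l : ℤ) + 1) * (k.choose (l + 1) : ℤ) = ((k : ℤ) - l) * (k.choose l : ℤ) := by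
  rcases le_or_gt l k with h | h
  · have := Nat.choose_succ_right_eq k l
    zify [h] at this
    linarith
  · simp [Nat.choose_eq_zero_of_lt h, Nat.choose_eq_zero_of_lt (Nat.lt_succ_of_lt h)]

theorem symChoose_succ (k m l : ℕ) :
    ((l : ℤ) + 1) ^ 2 * symChoose k m (l + 1)
      = ((k : ℤ) * m - l * ((k : ℤ) + m - l)) * symChoose k m l := by
  unfold symChoose
  linear_combination ((l : ℤ) + 1) * (m.choose (l + 1) : ℤ) * succ_mul_choose_succ_int k l
    + ((k : ℤ) - l) * (k.choose l : ℤ) * succ_mul_choose_succ_int m l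

theorem mul_sum_symChoose (k m : ℕ) (c : ℕ → ℤ) :
    ((k : ℤ) * m) * ∑ l ∈ Finset.range (k + m + 1), c l * symChoose k m l
      = ∑ l ∈ Finset.range (k + m + 1),
          ((l : ℤ) * ((k : ℤ) + m - l) * c l + (l : ℤ) ^ 2 * c (l - 1)) * symChoose k m l := by
  have shift : ∑ l ∈ Finset.range (k + m + 1), (l : ℤ) ^ 2 * c (l - 1) * symChoose k m l
      = ∑ l ∈ Finset.range (k + m + 1), c l * (((l : ℤ) + 1) ^ 2 * symChoose k m (l + 1)) := by
    rw [Finset.sum_range_succ', Finset.sum_range_succ _ (k + m)]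
    have : symChoose k m (k + m + 1) = 0 := by
      simp [symChoose, Nat.choose_eq_zero_of_lt (show k < k + m + 1 by omega)]
    rw [this]
    push_cast
    simp only [zero_mul, mul_zero]
    congr 1
    exact Finset.sum_congr rfl fun l _ => by ring
  simp_rw [add_mul]
  rw [Finset.sum_add_distrib, shift, Finset.mul_sum, ← Finset.sum_add_distrib]
  refine Finset.sum_congr rfl fun l _ => ?_
  rw [symChoose_succ]
  ring

theorem symCoeff_succ (N i j l : ℕ) (hl : l ≤ N) :
    ((j : ℤ) + 1) ^ 2 * symCoeff N i (j + 1) l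
      = ((l : ℤ) * ((N : ℤ) - l) - j * ((N : ℤ) - j)) * symCoeff N i j l
        + (l : ℤ) ^ 2 * symCoeff N i j (l - 1) := by
  have hj := succ_mul_choose_succ_int l j
  have pred : ∀ a, (l : ℤ) * ((l - 1).choose a : ℤ) = ((l : ℤ) - a) * (l.choose a : ℤ) := by
    intro a
    cases l with
    | zero => cases a <;> simp
    | succ l =>
      rcases le_or_gt a (l + 1) with h | h
      · have := Nat.choose_mul_succ_eq l a
        zify [h] at this
        push_cast
        linarith
      · simp [Nat.choose_eq_zero_of_lt h, Nat.choose_eq_zero_of_lt (show l < a by omega)]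
  have hi := pred i
  have hj' := pred j
  unfold symCoeff
  rcases lt_trichotomy l (i + j + 1) with h | h | h
  · obtain ⟨e, he⟩ : ∃ e, i + j = l + e := ⟨i + j - l, by omega⟩
    obtain ⟨M, rfl⟩ : ∃ M, N = l + M := ⟨N - l, by omega⟩
    rw [if_pos (by omega), if_pos (by omega), if_pos (by omega)]
    rw [show i + (j + 1) - l = e + 1 by omega, show i + j - l = e by omega,
      show l + M - l = M by omega]
    have hM := succ_mul_choose_succ_int M e
    have heZ : (i : ℤ) + j = l + e := by exact_mod_cast he
    rcases Nat.eq_zero_or_pos l with h0 | h0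
    · subst h0
      rcases Nat.eq_zero_or_pos j with hj0 | hj0
      · subst hj0
        simp
      · simp [Nat.choose_eq_zero_of_lt hj0]
    · rw [show i + j - (l - 1) = e + 1 by omega, show l + M - (l - 1) = M + 1 by omega,
        Nat.choose_succ_succ]
      push_cast
      have hi2 : (i : ℤ) = l + e - j := by linarith
      rw [hi2] at hi
      linear_combination ((j : ℤ) + 1) * (M.choose (e + 1) : ℤ) * (l.choose i : ℤ) * hj
        - ((M.choose e : ℤ) + (M.choose (e + 1) : ℤ)) * (l : ℤ) * ((l - 1).choose j : ℤ) * hi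
        - ((M.choose e : ℤ) + (M.choose (e + 1) : ℤ)) * ((j : ℤ) - e) * (l.choose i : ℤ) * hj'
        + ((l : ℤ) - j) * (l.choose j : ℤ) * (l.choose i : ℤ) * hM
  · rw [if_pos (by omega), if_neg (by omega), if_pos (by omega)]
    rw [show i + (j + 1) - l = 0 by omega, show i + j - (l - 1) = 0 by omega]
    simp only [Nat.choose_zero_right, Nat.cast_one]
    have hi2 : (i : ℤ) = l - j - 1 := by rw [h]; push_cast; ring
    rw [hi2] at hi
    linear_combination ((j : ℤ) + 1) * (l.choose i : ℤ) * hj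
      - (l : ℤ) * ((l - 1).choose j : ℤ) * hi - ((j : ℤ) + 1) * (l.choose i : ℤ) * hj'
  · rw [if_neg (by omega), if_neg (by omega), if_neg (by omega)]
    ring

theorem symChoose_mul (k m i j : ℕ) :
    symChoose k m i * symChoose k m j
      = ∑ l ∈ Finset.range (k + m + 1), symCoeff (k + m) i j l * symChoose k m l := by
  induction j with
  | zero =>
    have diag : ∀ l, symCoeff (k + m) i 0 l = if l = i then 1 else 0 := by
      intro l
      unfold symCoeff
      rcases lt_trichotomy l i with h | h | h
      · simp [Nat.choose_eq_zero_of_lt h, h.ne]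
      · simp [h]
      · rw [if_neg (by omega), if_neg (by omega)]
    simp only [diag, ite_mul, one_mul, zero_mul, Finset.sum_ite_eq', Finset.mem_range]
    split_ifs with h
    · simp [symChoose]
    · simp [symChoose, Nat.choose_eq_zero_of_lt (show k < i by omega)]
  | succ j ih =>
    have hpos : ((j : ℤ) + 1) ^ 2 ≠ 0 := by positivity
    apply mul_left_cancel₀ hpos
    have expand := mul_sum_symChoose k m (symCoeff (k + m) i j)
    rw [← ih] at expand
    calc ((j : ℤ) + 1) ^ 2 * (symChoose k m i * symChoose k m (j + 1))
        = (k : ℤ) * m * (symChoose k m i * symChoose k m j)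
          - j * ((k : ℤ) + m - j) * (symChoose k m i * symChoose k m j) := by
          linear_combination symChoose k m i * symChoose_succ k m j
      _ = _ := by
          rw [expand, ih, Finset.mul_sum, ← Finset.sum_sub_distrib, Finset.mul_sum]
          refine Finset.sum_congr rfl fun l hl => ?_
          have := symCoeff_succ (k + m) i j l (by simp at hl; omega)
          push_cast at this
          linear_combination - symChoose k m l * this

theorem choose_add_mul_choose_add (k m a : ℕ) :
    ((k + a).choose a : ℤ) * ((m + a).choose a : ℤ)
      = ∑ l ∈ Finset.range (k + m + 1),
          (if l ≤ a then ((k + m + a - l).choose (k + m) : ℤ) else 0) * symChoose k m l := by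
  induction a with
  | zero =>
    rw [Finset.sum_eq_single 0]
    · simp [symChoose]
    · intro l _ hl
      simp [hl]
    · simp
  | succ a ih =>
    have hpos : ((a : ℤ) + 1) ^ 2 ≠ 0 := by positivity
    apply mul_left_cancel₀ hpos
    have step : ∀ t : ℕ, ((a : ℤ) + 1) * ((t + (a + 1)).choose (a + 1) : ℤ)
        = ((t : ℤ) + a + 1) * ((t + a).choose a : ℤ) := by
      intro t
      have := Nat.add_one_mul_choose_eq (t + a) a
      zify at this
      rw [← add_assoc]
      linarith
    have expand := mul_sum_symChoose k m
      (fun l => if l ≤ a then ((k + m + a - l).choose (k + m) : ℤ) else 0)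
    rw [← ih] at expand
    calc ((a : ℤ) + 1) ^ 2 * (((k + (a + 1)).choose (a + 1) : ℤ) * ((m + (a + 1)).choose (a + 1) : ℤ))
        = (k : ℤ) * m * (((k + a).choose a : ℤ) * ((m + a).choose a : ℤ))
          + ((a : ℤ) + 1) * ((k : ℤ) + m + a + 1)
            * (((k + a).choose a : ℤ) * ((m + a).choose a : ℤ)) := by
          linear_combination ((a : ℤ) + 1) * ((m + (a + 1)).choose (a + 1) : ℤ) * step k
            + ((k : ℤ) + a + 1) * ((k + a).choose a : ℤ) * step m
      _ = _ := by
          rw [expand, ih, Finset.mul_sum, ← Finset.sum_add_distrib, Finset.mul_sum]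
          refine Finset.sum_congr rfl fun l hl => ?_
          generalize symChoose k m l = y
          have hN : (k : ℤ) + m = ((k + m : ℕ) : ℤ) := by push_cast; ring
          rw [hN]
          generalize k + m = N at *
          rcases lt_trichotomy l (a + 1) with h | h | h
          · rw [if_pos (by omega), if_pos (by omega), if_pos (by omega)]
            obtain ⟨d, rfl⟩ : ∃ d, a = l + d := ⟨a - l, by omega⟩
            rw [show N + (l + d) - l = N + d by omega, show N + (l + d + 1) - l = N + d + 1 by omega]
            have key := Nat.choose_mul_succ_eq (N + d) N
            rw [show N + d + 1 - N = d + 1 by omega] at key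
            zify at key
            rcases Nat.eq_zero_or_pos l with h0 | h0
            · subst h0
              push_cast
              linear_combination y * ((d : ℤ) + 1) * key
            · rw [show N + (l + d) - (l - 1) = N + d + 1 by omega]
              push_cast
              linear_combination y * ((d : ℤ) + 1 + 2 * l) * key
          · subst h
            simp
          · rw [if_neg (by omega), if_neg (by omega), if_neg (by omega)]
            ring

theorem catT_eq (k m : ℕ) :
    ((k : ℤ) + m + 1) * catT (k + m) k = ((m : ℤ) + 1) * ((k + (k + m)).choose (k + m) : ℤ) := by
  unfold catT
  have := succ_mul_choose_succ_int (k + m + k) (k + m)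
  rw [add_comm k (k + m)]
  push_cast at this ⊢
  linear_combination - this

/-- `(N+1)^2` times the coefficients of `C(N,k) * C(N,N-k)` in the family `symChoose`. -/
def catCoeff (N s : ℕ) : ℤ :=
  ((N : ℤ) + 1) ^ 2 * (((2 * N - s).choose (N + 1 - s) : ℤ) - ((2 * N - s).choose N : ℤ))
    + 2 * ((N : ℤ) + 1) * ((2 * N - s).choose N : ℤ)

theorem catCoeff_eq (N s : ℕ) (hs : s ≤ N) :
    catCoeff N s = ((N : ℤ) + 1 + s * ((N : ℤ) - s)) * ((2 * N - s).choose N : ℤ)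
      + (s : ℤ) ^ 2 * ((2 * N - (s - 1)).choose N : ℤ) := by
  obtain ⟨d, rfl⟩ : ∃ d, N = s + d := ⟨N - s, by omega⟩
  have hd : ((d : ℤ) + 1) ≠ 0 := by positivity
  apply mul_left_cancel₀ hd
  unfold catCoeff
  rw [show 2 * (s + d) - s = s + d + d by omega, show s + d + 1 - s = d + 1 by omega]
  have h1 := succ_mul_choose_succ_int (s + d + d) d
  rw [Nat.choose_symm_add (a := s + d) (b := d)]
  have h2 := Nat.add_one_mul_choose_eq (s + d + d) d
  zify at h2
  have h3 : (s : ℤ) ^ 2 * ((2 * (s + d) - (s - 1)).choose (s + d) : ℤ)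
      = (s : ℤ) ^ 2 * ((s + d + d + 1).choose (d + 1) : ℤ) := by
    rcases Nat.eq_zero_or_pos s with h0 | h0
    · simp [h0]
    · rw [show 2 * (s + d) - (s - 1) = s + d + (d + 1) by omega, Nat.choose_symm_add]
      rfl
  rw [h3]
  push_cast at h1 h2 ⊢
  linear_combination ((s : ℤ) + d + 1) ^ 2 * h1 + (s : ℤ) ^ 2 * h2

theorem catT_mul_catT (k m : ℕ) :
    ((k : ℤ) + m + 1) ^ 2 * (catT (k + m) k * catT (k + m) m)
      = ∑ l ∈ Finset.range (k + m + 1), catCoeff (k + m) l * symChoose k m l := by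
  have hk := catT_eq k m
  have hm := catT_eq m k
  rw [add_comm m k] at hm
  have hP := choose_add_mul_choose_add k m (k + m)
  have expand := mul_sum_symChoose k m
    (fun l => if l ≤ k + m then ((k + m + (k + m) - l).choose (k + m) : ℤ) else 0)
  rw [← hP] at expand
  calc ((k : ℤ) + m + 1) ^ 2 * (catT (k + m) k * catT (k + m) m)
      = (k : ℤ) * m * (((k + (k + m)).choose (k + m) : ℤ) * ((m + (k + m)).choose (k + m) : ℤ))
        + ((k : ℤ) + m + 1)
          * (((k + (k + m)).choose (k + m) : ℤ) * ((m + (k + m)).choose (k + m) : ℤ)) := by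
        linear_combination ((k : ℤ) + m + 1) * catT (k + m) m * hk
          + ((m : ℤ) + 1) * ((k + (k + m)).choose (k + m) : ℤ) * hm
    _ = _ := by
        rw [expand, hP, Finset.mul_sum, ← Finset.sum_add_distrib]
        refine Finset.sum_congr rfl fun l hl => ?_
        have hl' : l ≤ k + m := by simp at hl; omega
        rw [catCoeff_eq _ _ hl', if_pos hl', if_pos (by omega), two_mul]
        push_cast
        ring

theorem sq_dvd_choose_mul_catCoeff (n s : ℕ) (hs : s ≤ n) :
    (2 * (n : ℤ) + 1) ^ 2 ∣ (n.choose s : ℤ) * catCoeff (2 * n) s := by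
  have hA : (2 * (n : ℤ) + 1) ∣ (n.choose s : ℤ) * ((2 * (2 * n) - s).choose (2 * n) : ℤ) := by
    have hcop : IsCoprime (2 * (n : ℤ) + 1) ((n : ℤ) + 1) := ⟨-1, 2, by ring⟩
    apply hcop.dvd_of_dvd_mul_left
    have h1 := succ_mul_choose_succ_int (2 * (2 * n) - s) (2 * n)
    have h2 := Nat.add_one_mul_choose_eq n s
    zify at h2
    push_cast [show s ≤ 2 * (2 * n) by omega] at h1
    refine ⟨((n + 1).choose (s + 1) : ℤ) * (((2 * (2 * n) - s).choose (2 * n) : ℤ)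
      - ((2 * (2 * n) - s).choose (2 * n + 1) : ℤ)), ?_⟩
    linear_combination ((2 * (2 * n) - s).choose (2 * n) : ℤ) * h2
      + ((n + 1).choose (s + 1) : ℤ) * h1
  obtain ⟨t, ht⟩ := hA
  unfold catCoeff
  push_cast
  refine ⟨(n.choose s : ℤ) * (((2 * (2 * n) - s).choose (2 * n + 1 - s) : ℤ)
    - ((2 * (2 * n) - s).choose (2 * n) : ℤ)) + 2 * t, ?_⟩
  linear_combination 2 * (2 * (n : ℤ) + 1) * ht

theorem choose_mul_symChoose (k m j : ℕ) :
    ((k + m).choose k : ℤ) * symChoose k m j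
      = ∑ l ∈ Finset.range (k + m + 1),
          ((k + m).choose j : ℤ) * (l.choose j : ℤ) * symChoose k m l := by
  rcases lt_or_ge k j with hkj | hjk
  · rw [Finset.sum_eq_zero fun l _ => ?_]
    · simp [symChoose, Nat.choose_eq_zero_of_lt hkj]
    · rcases lt_or_ge l j with h | h
      · simp [Nat.choose_eq_zero_of_lt h]
      · simp [symChoose, Nat.choose_eq_zero_of_lt (show k < l by omega)]
  have trunc : ∑ l ∈ Finset.range (k + m + 1),
        ((k + m).choose j : ℤ) * (l.choose j : ℤ) * symChoose k m l
      = ∑ l ∈ Finset.range (k + 1),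
        ((k + m).choose j : ℤ) * (l.choose j : ℤ) * symChoose k m l := by
    symm
    apply Finset.sum_subset
    · intro l hl
      rw [Finset.mem_range] at *
      omega
    · intro l _ hl
      rw [Finset.mem_range] at hl
      simp [symChoose, Nat.choose_eq_zero_of_lt (show k < l by omega)]
  have vandermonde := Nat.add_choose_eq m (k - j) k
  rw [Finset.Nat.sum_antidiagonal_eq_sum_range_succ
    (fun a b => m.choose a * (k - j).choose b)] at vandermonde
  have outer : (k + m).choose k * m.choose j = (k + m).choose j * (m + (k - j)).choose k := by
    rcases lt_or_ge m j with h | h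
    · simp [Nat.choose_eq_zero_of_lt h, Nat.choose_eq_zero_of_lt (show m + (k - j) < k by omega)]
    · rw [Nat.choose_symm_add, Nat.choose_mul h, show k + m - j = m + (k - j) by omega,
        Nat.choose_symm_of_eq_add (show m + (k - j) = (m - j) + k by omega)]
  rw [trunc]
  have inner : ∀ l ∈ Finset.range (k + 1),
      ((k + m).choose j : ℤ) * (l.choose j : ℤ) * symChoose k m l
        = ((k + m).choose j : ℤ) * (k.choose j : ℤ)
          * ((m.choose l : ℤ) * ((k - j).choose (k - l) : ℤ)) := by
    intro l hl
    rw [Finset.mem_range] at hl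
    have : k.choose l * l.choose j = k.choose j * (k - j).choose (k - l) := by
      rcases lt_or_ge l j with h | h
      · simp [Nat.choose_eq_zero_of_lt h, Nat.choose_eq_zero_of_lt (show k - j < k - l by omega)]
      · rw [Nat.choose_mul h,
          Nat.choose_symm_of_eq_add (show k - j = (l - j) + (k - l) by omega)]
    zify at this
    unfold symChoose
    linear_combination ((k + m).choose j : ℤ) * (m.choose l : ℤ) * this
  rw [Finset.sum_congr rfl inner, ← Finset.mul_sum]
  zify at vandermonde outer
  rw [← vandermonde]
  unfold symChoose
  linear_combination (k.choose j : ℤ) * outer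

theorem exists_choose_pow_eq_sum (N t : ℕ) :
    ∃ c : ℕ → ℤ, ∀ k m, k + m = N →
      (N.choose k : ℤ) ^ t = ∑ l ∈ Finset.range (N + 1), c l * symChoose k m l := by
  induction t with
  | zero =>
    refine ⟨fun l => if l = 0 then 1 else 0, fun k m _ => ?_⟩
    simp [symChoose]
  | succ t ih =>
    obtain ⟨c, hc⟩ := ih
    refine ⟨fun l => ∑ j ∈ Finset.range (N + 1), c j * ((N.choose j : ℤ) * (l.choose j : ℤ)),
      fun k m h => ?_⟩
    rw [pow_succ, hc k m h, Finset.sum_mul]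
    simp_rw [Finset.sum_mul]
    rw [Finset.sum_comm]
    refine Finset.sum_congr rfl fun j _ => ?_
    subst h
    rw [mul_assoc, mul_comm (symChoose k m j), choose_mul_symChoose, Finset.mul_sum]
    exact Finset.sum_congr rfl fun l _ => by ring

theorem alternating_sum_symChoose (n l : ℕ) :
    ∑ k ∈ Finset.range (2 * n + 1),
        (-1 : ℤ) ^ k * ((2 * n).choose k : ℤ) * symChoose k (2 * n - k) l
      = if l = n then (-1) ^ n * ((2 * n).choose n : ℤ) else 0 := by
  rcases lt_or_ge n l with hnl | hln
  · rw [if_neg (by omega)]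
    refine Finset.sum_eq_zero fun k _ => ?_
    rcases lt_or_ge k l with h | h
    · simp [symChoose, Nat.choose_eq_zero_of_lt h]
    · simp [symChoose, Nat.choose_eq_zero_of_lt (show 2 * n - k < l by omega)]
  obtain ⟨M, hM⟩ : ∃ M, 2 * n = l + M + l := ⟨2 * n - 2 * l, by omega⟩
  rw [show 2 * n + 1 = l + (M + 1) + l by omega, Finset.sum_range_add, Finset.sum_range_add,
    Finset.sum_eq_zero (s := Finset.range l), Finset.sum_eq_zero (s := Finset.range l)]
  · have term : ∀ u ∈ Finset.range (M + 1),
        (-1 : ℤ) ^ (l + u) * ((2 * n).choose (l + u) : ℤ) * symChoose (l + u) (2 * n - (l + u)) l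
          = (-1) ^ l * ((2 * n).choose l : ℤ) * ((l + M).choose l : ℤ)
            * ((-1) ^ u * (M.choose u : ℤ)) := by
      intro u hu
      rw [Finset.mem_range] at hu
      have h1 : (2 * n).choose (l + u) * (l + u).choose l
          = (2 * n).choose l * (l + M).choose u := by
        rw [Nat.choose_mul (by omega), show 2 * n - l = l + M by omega,
          Nat.add_sub_cancel_left]
      have h2 : (l + M).choose u * (2 * n - (l + u)).choose l
          = (l + M).choose l * M.choose u := by
        rw [Nat.choose_symm_of_eq_add (show l + M = u + (2 * n - (l + u)) by omega),
          Nat.choose_mul (by omega), Nat.add_sub_cancel_left,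
          Nat.choose_symm_of_eq_add (show M = u + (2 * n - (l + u) - l) by omega)]
      zify at h1 h2
      unfold symChoose
      rw [pow_add]
      linear_combination (-1) ^ l * (-1) ^ u * ((2 * n - (l + u)).choose l : ℤ) * h1
        + (-1) ^ l * (-1) ^ u * ((2 * n).choose l : ℤ) * h2
    rw [Finset.sum_congr rfl term, ← Finset.mul_sum, Int.alternating_sum_range_choose]
    rcases eq_or_ne l n with h | h
    · obtain rfl : M = 0 := by omega
      simp [h]
    · rw [if_neg (by omega), if_neg h]
      simp
  · intro u hu
    rw [Finset.mem_range] at hu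
    simp [symChoose, Nat.choose_eq_zero_of_lt (show 2 * n - (l + (M + 1) + u) < l by omega)]
  · intro u hu
    simp [symChoose, Nat.choose_eq_zero_of_lt (Finset.mem_range.mp hu)]

theorem choose_dvd_of_symChoose_mul (n i s : ℕ) (e : ℤ) (M : ℤ) (h : M ∣ (n.choose s : ℤ) * e) :
    M * ((2 * n).choose n : ℤ) ∣ ∑ k ∈ Finset.range (2 * n + 1),
      (-1 : ℤ) ^ k * ((2 * n).choose k : ℤ)
        * (symChoose k (2 * n - k) i * (e * symChoose k (2 * n - k) s)) := by
  have eval : ∑ k ∈ Finset.range (2 * n + 1), (-1 : ℤ) ^ k * ((2 * n).choose k : ℤ)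
        * (symChoose k (2 * n - k) i * (e * symChoose k (2 * n - k) s))
      = e * (symCoeff (2 * n) i s n * ((-1) ^ n * ((2 * n).choose n : ℤ))) := by
    calc _ = ∑ k ∈ Finset.range (2 * n + 1), ∑ l ∈ Finset.range (2 * n + 1),
          e * symCoeff (2 * n) i s l
            * ((-1 : ℤ) ^ k * ((2 * n).choose k : ℤ) * symChoose k (2 * n - k) l) := by
          refine Finset.sum_congr rfl fun k hk => ?_
          have hprod := symChoose_mul k (2 * n - k) i s
          rw [show k + (2 * n - k) = 2 * n by simp at hk; omega] at hprod
          rw [mul_left_comm _ e, hprod, Finset.mul_sum, Finset.mul_sum]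
          exact Finset.sum_congr rfl fun l _ => by ring
      _ = _ := by
          rw [Finset.sum_comm]
          simp_rw [← Finset.mul_sum, alternating_sum_symChoose]
          simp only [mul_ite, mul_zero, Finset.sum_ite_eq', Finset.mem_range]
          rw [if_pos (by omega)]
          ring
  rw [eval]
  unfold symCoeff
  split_ifs
  · obtain ⟨t, ht⟩ := h
    refine ⟨t * ((2 * n - n).choose (i + s - n) : ℤ) * (n.choose i : ℤ) * (-1) ^ n, ?_⟩
    linear_combination ((2 * n - n).choose (i + s - n) : ℤ) * (n.choose i : ℤ) * (-1) ^ n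
      * ((2 * n).choose n : ℤ) * ht
  · simp

theorem stmt2 (n m : ℕ) (hm : 1 ≤ m) :
    (((2 * n).choose n : ℤ)) ∣ S n m := by
  obtain ⟨t, rfl⟩ : ∃ t, m = t + 1 := ⟨m - 1, by omega⟩
  obtain ⟨c, hc⟩ := exists_choose_pow_eq_sum (2 * n) t
  have hpos : (2 * (n : ℤ) + 1) ^ 2 ≠ 0 := by positivity
  rw [← mul_dvd_mul_iff_left hpos]
  have expand : (2 * (n : ℤ) + 1) ^ 2 * S n (t + 1)
      = ∑ i ∈ Finset.range (2 * n + 1), c i * ∑ s ∈ Finset.range (2 * n + 1),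
          ∑ k ∈ Finset.range (2 * n + 1), (-1 : ℤ) ^ k * ((2 * n).choose k : ℤ)
            * (symChoose k (2 * n - k) i * (catCoeff (2 * n) s * symChoose k (2 * n - k) s)) := by
    unfold S
    simp_rw [Finset.mul_sum]
    conv_rhs => enter [2, i]; rw [Finset.sum_comm]
    rw [Finset.sum_comm]
    refine Finset.sum_congr rfl fun k hk => ?_
    have hk' : k + (2 * n - k) = 2 * n := by simp at hk; omega
    have hQ := catT_mul_catT k (2 * n - k)
    rw [hk', show (k : ℤ) + ((2 * n - k : ℕ) : ℤ) = 2 * n by exact_mod_cast hk'] at hQ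
    calc _ = (-1 : ℤ) ^ k * ((2 * n).choose k : ℤ) * (((2 * n).choose k : ℤ) ^ t
          * ((2 * (n : ℤ) + 1) ^ 2 * (catT (2 * n) k * catT (2 * n) (2 * n - k)))) := by ring
      _ = _ := by
          rw [hQ, hc k _ hk', Finset.sum_mul, Finset.mul_sum]
          refine Finset.sum_congr rfl fun i _ => ?_
          rw [Finset.mul_sum, Finset.mul_sum]
          exact Finset.sum_congr rfl fun s _ => by ring
  rw [expand]
  refine Finset.dvd_sum fun i _ => Dvd.dvd.mul_left (Finset.dvd_sum fun s _ => ?_) _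
  apply choose_dvd_of_symChoose_mul
  rcases le_or_gt s n with hs | hs
  · exact sq_dvd_choose_mul_catCoeff n s hs
  · simp [Nat.choose_eq_zero_of_lt hs]
end

section
/- Let n ≥ 1 be a natural number and let j be a non-negative integer with j ≤ n. Then the number of lattice paths in the plane from (0,0) to (n,2n), using steps (1,0), (0,1) and (1,1), that never go below the line y = 2x and that use exactly j steps of the form (1,0), equals T(n,j) = binom(2n+j,j)*binom(2n+1,n+j+1)/(2n+1); equivalently, n times this number of paths equals binom(n,j)*binom(2n+j,n-1). -/
/-- A valid step of a lattice path: `(1,0)`, `(0,1)` or `(1,1)`. -/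
def IsStep (s : ℕ × ℕ) : Prop := s = (1, 0) ∨ s = (0, 1) ∨ s = (1, 1)

/-- `schr a b slope j` is the number of lattice paths (encoded as lists of steps,
read left to right) from `(0,0)` to `(a,b)` using steps `(1,0)`, `(0,1)`, `(1,1)`,
that never go below the line `y = slope * x` (i.e. every partial sum `(x,y)`
satisfies `y ≥ slope * x`), and that use exactly `j` steps of the form `(1,0)`. -/
noncomputable def schr (a b slope j : ℕ) : ℕ :=
  Set.ncard {l : List (ℕ × ℕ) |
    (∀ s ∈ l, IsStep s) ∧
    (l.map Prod.fst).sum = a ∧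
    (l.map Prod.snd).sum = b ∧
    (∀ p : List (ℕ × ℕ), p <+: l →
      slope * (p.map Prod.fst).sum ≤ (p.map Prod.snd).sum) ∧
    l.count (1, 0) = j}

open Nat in
theorem lastStep_factorial_identity (a b c : ℕ) (h : b + 2 * c ≤ a + 1) :
    (a + 1 - b - 2 * c) * (a + 2) * (a + b + c)! + (a + 3 - b - 2 * c) * b * (a + b + c)! +
        (a + 4 - b - 2 * c) * c * (a + b + c)! =
      (a + 2 - b - 2 * c) * (a + 1 + b + c)! := by
  obtain ⟨k, hk⟩ := Nat.exists_eq_add_of_le h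
  rw [show a + 1 - b - 2 * c = k by omega, show a + 3 - b - 2 * c = k + 2 by omega,
    show a + 4 - b - 2 * c = k + 3 by omega, show a + 2 - b - 2 * c = k + 1 by omega,
    show a + 1 + b + c = (a + b + c) + 1 by ring, Nat.factorial_succ]
  have ha : k * (a + 2) + (k + 2) * b + (k + 3) * c = (k + 1) * (a + b + c + 1) := by
    nlinarith
  rw [← mul_assoc, ← ha]
  ring

/-- Lattice paths that never go below `y = 2x`, with `a` steps `(0,1)`, `b` steps `(1,1)` and
`c` steps `(1,0)`. -/
def pathsAbove (a b c : ℕ) : Set (List (ℕ × ℕ)) :=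
  {l | (∀ s ∈ l, IsStep s) ∧ l.count (0, 1) = a ∧ l.count (1, 1) = b ∧ l.count (1, 0) = c ∧
    ∀ p : List (ℕ × ℕ), p <+: l → 2 * (p.map Prod.fst).sum ≤ (p.map Prod.snd).sum}

theorem sum_eq_count_of_isStep (l : List (ℕ × ℕ)) (hl : ∀ s ∈ l, IsStep s) :
    (l.map Prod.fst).sum = l.count (1, 1) + l.count (1, 0) ∧
      (l.map Prod.snd).sum = l.count (0, 1) + l.count (1, 1) := by
  induction l with
  | nil => simp
  | cons s l ih =>
    obtain ⟨h1, h2⟩ := ih fun t ht => hl t (List.mem_cons_of_mem _ ht)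
    rcases hl s List.mem_cons_self with rfl | rfl | rfl <;>
      simp [h1, h2] <;> omega

theorem le_of_mem_pathsAbove {a b c : ℕ} {l : List (ℕ × ℕ)} (hl : l ∈ pathsAbove a b c) :
    b + 2 * c ≤ a := by
  obtain ⟨hs, ha, hb, hc, hp⟩ := hl
  have h := hp l List.prefix_rfl
  obtain ⟨h1, h2⟩ := sum_eq_count_of_isStep l hs
  omega

theorem concat_mem_pathsAbove_iff {a b c : ℕ} (h : b + 2 * c ≤ a) (l : List (ℕ × ℕ))
    (s : ℕ × ℕ) :
    l ++ [s] ∈ pathsAbove a b c ↔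
      (s = (0, 1) ∧ ∃ a', a = a' + 1 ∧ l ∈ pathsAbove a' b c) ∨
      (s = (1, 1) ∧ ∃ b', b = b' + 1 ∧ l ∈ pathsAbove a b' c) ∨
      (s = (1, 0) ∧ ∃ c', c = c' + 1 ∧ l ∈ pathsAbove a b c') := by
  constructor
  · rintro ⟨hs, ha, hb, hc, hp⟩
    have hs' : ∀ t ∈ l, IsStep t := fun t ht => hs t (by simp [ht])
    have hp' : ∀ p : List (ℕ × ℕ), p <+: l →
        2 * (p.map Prod.fst).sum ≤ (p.map Prod.snd).sum :=
      fun p hpl => hp p (hpl.trans (List.prefix_append _ _))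
    rcases hs s (by simp) with rfl | rfl | rfl <;> simp at ha hb hc
    · exact .inr (.inr ⟨rfl, _, hc.symm, hs', ha, hb, rfl, hp'⟩)
    · exact .inl ⟨rfl, _, ha.symm, hs', rfl, hb, hc, hp'⟩
    · exact .inr (.inl ⟨rfl, _, hb.symm, hs', ha, rfl, hc, hp'⟩)
  · have key (hs : IsStep s) (hl : ∀ t ∈ l, IsStep t) : ∀ t ∈ l ++ [s], IsStep t := by
      intro t ht
      rcases List.mem_append.1 ht with ht | ht
      · exact hl t ht
      · rwa [List.mem_singleton.1 ht]
    rintro (⟨rfl, _, rfl, hs, ha, hb, hc, hp⟩ | ⟨rfl, _, rfl, hs, ha, hb, hc, hp⟩ |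
      ⟨rfl, _, rfl, hs, ha, hb, hc, hp⟩)
    all_goals
      refine ⟨key (by simp [IsStep]) hs, by simp [ha], by simp [hb], by simp [hc], ?_⟩
      intro p hpl
      rcases List.prefix_concat_iff.1 hpl with rfl | hpl
      · obtain ⟨h1, h2⟩ := sum_eq_count_of_isStep l hs
        simp [h1, h2, ha, hb, hc]
        omega
      · exact hp p hpl

theorem pathsAbove_zero : pathsAbove 0 0 0 = {[]} := by
  ext l
  constructor
  · rintro ⟨hs, ha, hb, hc, -⟩
    refine List.eq_nil_iff_forall_not_mem.2 fun s hsl => ?_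
    rcases hs s hsl with rfl | rfl | rfl
    · exact List.count_eq_zero.1 hc hsl
    · exact List.count_eq_zero.1 ha hsl
    · exact List.count_eq_zero.1 hb hsl
  · rintro rfl
    simp [pathsAbove]

theorem pathsAbove_succ {a b c : ℕ} (h : b + 2 * c ≤ a + 1) :
    pathsAbove (a + 1) b c =
      (· ++ [(0, 1)]) '' pathsAbove a b c ∪
        ((· ++ [(1, 1)]) '' {l | ∃ b', b = b' + 1 ∧ l ∈ pathsAbove (a + 1) b' c} ∪
          (· ++ [(1, 0)]) '' {l | ∃ c', c = c' + 1 ∧ l ∈ pathsAbove (a + 1) b c'}) := by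
  ext l
  rcases List.eq_nil_or_concat' l with rfl | ⟨l, s, rfl⟩
  · simp [pathsAbove]
  · rw [concat_mem_pathsAbove_iff h]
    have hc (x : List (ℕ × ℕ)) (t : ℕ × ℕ) : x ++ [t] = l ++ [s] ↔ x = l ∧ s = t :=
      ⟨fun e => ⟨List.append_inj_left' e rfl,
          (List.singleton_inj.1 (List.append_inj_right' e rfl)).symm⟩,
        by rintro ⟨rfl, rfl⟩; rfl⟩
    simp [hc, ← and_assoc, and_comm]

open Nat in
theorem finite_and_ncard_pathsAbove (a b c : ℕ) :
    (pathsAbove a b c).Finite ∧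
      (pathsAbove a b c).ncard * ((a + 1)! * b ! * c !) =
        (a + 1 - b - 2 * c) * (a + b + c)! := by
  induction hm : a + b + c using Nat.strong_induction_on generalizing a b c with
  | _ m ih =>
  subst hm
  by_cases h : b + 2 * c ≤ a
  swap
  · have he : pathsAbove a b c = ∅ :=
      Set.eq_empty_of_forall_notMem fun l hl => h (le_of_mem_pathsAbove hl)
    simp only [he, Set.finite_empty, Set.ncard_empty, true_and, zero_mul]
    rw [show a + 1 - b - 2 * c = 0 by omega, zero_mul]
  rcases a with _ | a
  · obtain ⟨rfl, rfl⟩ : b = 0 ∧ c = 0 := by omega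
    simp [pathsAbove_zero]
  obtain ⟨fN, hN⟩ := ih (a + b + c) (by omega) a b c rfl
  obtain ⟨fD, hD⟩ : {l | ∃ b', b = b' + 1 ∧ l ∈ pathsAbove (a + 1) b' c}.Finite ∧
      {l | ∃ b', b = b' + 1 ∧ l ∈ pathsAbove (a + 1) b' c}.ncard * ((a + 2)! * b ! * c !) =
        (a + 3 - b - 2 * c) * b * (a + b + c)! := by
    rcases b with _ | b
    · simp
    · obtain ⟨f, hf⟩ := ih (a + 1 + b + c) (by omega) (a + 1) b c rfl
      simp only [Nat.add_right_cancel_iff, exists_eq_left', Set.ofPred_mem_eq, Nat.factorial_succ b]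
      refine ⟨f, ?_⟩
      rw [show a + (b + 1) + c = a + 1 + b + c by ring,
        show a + 3 - (b + 1) - 2 * c = a + 1 + 1 - b - 2 * c by omega]
      linear_combination (b + 1) * hf
  obtain ⟨fE, hE⟩ : {l | ∃ c', c = c' + 1 ∧ l ∈ pathsAbove (a + 1) b c'}.Finite ∧
      {l | ∃ c', c = c' + 1 ∧ l ∈ pathsAbove (a + 1) b c'}.ncard * ((a + 2)! * b ! * c !) =
        (a + 4 - b - 2 * c) * c * (a + b + c)! := by
    rcases c with _ | c
    · simp
    · obtain ⟨f, hf⟩ := ih (a + 1 + b + c) (by omega) (a + 1) b c rfl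
      simp only [Nat.add_right_cancel_iff, exists_eq_left', Set.ofPred_mem_eq, Nat.factorial_succ c]
      refine ⟨f, ?_⟩
      rw [show a + b + (c + 1) = a + 1 + b + c by ring,
        show a + 4 - b - 2 * (c + 1) = a + 1 + 1 - b - 2 * c by omega]
      linear_combination (c + 1) * hf
  have hinj (s : ℕ × ℕ) : Function.Injective (fun l : List (ℕ × ℕ) => l ++ [s]) :=
    fun _ _ => List.append_cancel_right
  have hdisj {s t : ℕ × ℕ} (hst : s ≠ t) (S T : Set (List (ℕ × ℕ))) :
      Disjoint ((fun l => l ++ [s]) '' S) ((fun l => l ++ [t]) '' T) := by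
    rw [Set.disjoint_left]
    rintro _ ⟨l, -, rfl⟩ ⟨l', -, h'⟩
    exact hst (List.singleton_inj.1 (List.append_inj_right' h' rfl)).symm
  rw [pathsAbove_succ h]
  refine ⟨(fN.image _).union ((fD.image _).union (fE.image _)), ?_⟩
  rw [Set.ncard_union_eq (Set.disjoint_union_right.2 ⟨hdisj (by simp) _ _, hdisj (by simp) _ _⟩)
      (fN.image _) ((fD.image _).union (fE.image _)),
    Set.ncard_union_eq (hdisj (by simp) _ _) (fD.image _) (fE.image _),
    Set.ncard_image_of_injective _ (hinj _), Set.ncard_image_of_injective _ (hinj _),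
    Set.ncard_image_of_injective _ (hinj _), ← lastStep_factorial_identity a b c h, ← hD, ← hE,
    show a + 1 + 1 = a + 2 by rfl, Nat.factorial_succ (a + 1)]
  linear_combination (a + 2) * hN

theorem schr_eq_ncard_pathsAbove {n j : ℕ} (hj : j ≤ n) :
    schr n (2 * n) 2 j = (pathsAbove (n + j) (n - j) j).ncard := by
  unfold schr pathsAbove
  congr 1
  ext l
  constructor
  · rintro ⟨hs, h1, h2, hp, hc⟩
    obtain ⟨e1, e2⟩ := sum_eq_count_of_isStep l hs
    exact ⟨hs, by omega, by omega, hc, hp⟩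
  · rintro ⟨hs, ha, hb, hc, hp⟩
    obtain ⟨e1, e2⟩ := sum_eq_count_of_isStep l hs
    exact ⟨hs, by omega, by omega, hp, hc⟩

open Nat in
theorem schr_mul_factorial {n j : ℕ} (hj : j ≤ n) :
    schr n (2 * n) 2 j * ((n + j + 1)! * (n - j)! * j !) = (2 * n + j)! := by
  rw [schr_eq_ncard_pathsAbove hj, (finite_and_ncard_pathsAbove _ _ _).2,
    show n + j + 1 - (n - j) - 2 * j = 1 by omega,
    show n + j + (n - j) + j = 2 * n + j by omega, one_mul]

theorem stmt3 (n j : ℕ) (hn : 1 ≤ n) (hj : j ≤ n) :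
    (2 * n + 1) * schr n (2 * n) 2 j =
        (2 * n + j).choose j * (2 * n + 1).choose (n + j + 1) ∧
      n * schr n (2 * n) 2 j = n.choose j * (2 * n + j).choose (n - 1) := by
  have hX := schr_mul_factorial hj
  constructor
  · have h1 := Nat.choose_mul_factorial_mul_factorial (show j ≤ 2 * n + j by omega)
    have h2 := Nat.choose_mul_factorial_mul_factorial (show n + j + 1 ≤ 2 * n + 1 by omega)
    rw [show 2 * n + j - j = 2 * n by omega] at h1
    rw [show 2 * n + 1 - (n + j + 1) = n - j by omega, Nat.factorial_succ (2 * n)] at h2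
    refine Nat.eq_of_mul_eq_mul_right (m := (2 * n).factorial * ((n + j + 1).factorial *
      (n - j).factorial * j.factorial)) (by positivity) ?_
    zify at *
    linear_combination (2 * n + 1) * ((2 * n).factorial : ℤ) * hX -
      ((2 * n + 1).choose (n + j + 1) * (n + j + 1).factorial * (n - j).factorial : ℤ) * h1 -
      ((2 * n + j).factorial : ℤ) * h2
  · have h1 := Nat.choose_mul_factorial_mul_factorial hj
    have h2 := Nat.choose_mul_factorial_mul_factorial (show n - 1 ≤ 2 * n + j by omega)
    have h3 := Nat.mul_factorial_pred (show n ≠ 0 by omega)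
    rw [show 2 * n + j - (n - 1) = n + j + 1 by omega] at h2
    refine Nat.eq_of_mul_eq_mul_right (m := (n - 1).factorial * ((n + j + 1).factorial *
      (n - j).factorial * j.factorial)) (by positivity) ?_
    generalize (n - 1).factorial = p at *
    generalize (n - j).factorial = q at *
    generalize (2 * n + j).choose (n - 1) = r at *
    zify at *
    linear_combination (n : ℤ) * p * hX + ((2 * n + j).factorial : ℤ) * h3 -
      (r * p * (n + j + 1).factorial : ℤ) * h1 - (n.factorial : ℤ) * h2
end

section
/- Let n ≥ 1 be a natural number, let j be a non-negative integer with j ≤ n, and let m be a natural number with m ≥ 2n. Then Schr(n,m,j,2), the number of lattice paths from (0,0) to (n,m) using steps (1,0), (0,1) and (1,1) that never go below the line y = 2x and have exactly j steps of the form (1,0), satisfies n * Schr(n,m,j,2) = (m-2n+1) * binom(n,j) * binom(m+j,n-1). -/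
/-- The set of lattice paths counted by `schr a b slope j`. -/
def schrSet (a b slope j : ℕ) : Set (List (ℕ × ℕ)) :=
  {l | (∀ s ∈ l, IsStep s) ∧
    (l.map Prod.fst).sum = a ∧
    (l.map Prod.snd).sum = b ∧
    (∀ p : List (ℕ × ℕ), p <+: l →
      slope * (p.map Prod.fst).sum ≤ (p.map Prod.snd).sum) ∧
    l.count (1, 0) = j}

theorem schr_eq_ncard_schrSet (a b k j : ℕ) : schr a b k j = (schrSet a b k j).ncard := rfl

theorem concat_mem_schrSet {a b k j : ℕ} {l : List (ℕ × ℕ)} {s : ℕ × ℕ} :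
    l ++ [s] ∈ schrSet a b k j ↔ IsStep s ∧ k * a ≤ b ∧ ∃ a' b' j', l ∈ schrSet a' b' k j' ∧
      a' + s.1 = a ∧ b' + s.2 = b ∧ j' + [s].count (1, 0) = j := by
  simp only [schrSet, Set.mem_ofPred_eq, List.prefix_concat_iff, List.mem_append,
    List.mem_singleton, List.map_append, List.sum_append, List.count_append, List.map_cons,
    List.map_nil, List.sum_singleton]
  constructor
  · rintro ⟨hs, rfl, rfl, hp, rfl⟩
    refine ⟨hs s (Or.inr rfl), ?_, _, _, _,
      ⟨fun t ht => hs t (Or.inl ht), rfl, rfl, fun p h => hp p (Or.inr h), rfl⟩, rfl, rfl, rfl⟩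
    simpa using hp _ (Or.inl rfl)
  · rintro ⟨hs, hk, _, _, _, ⟨hl, rfl, rfl, hp, rfl⟩, rfl, rfl, rfl⟩
    refine ⟨?_, rfl, rfl, ?_, rfl⟩
    · rintro t (ht | rfl)
      exacts [hl t ht, hs]
    · rintro p (rfl | h)
      · simpa using hk
      · exact hp p h

theorem le_of_mem_schrSet {a b k j : ℕ} {l : List (ℕ × ℕ)} (h : l ∈ schrSet a b k j) :
    k * a ≤ b := by
  obtain ⟨-, rfl, rfl, hp, -⟩ := h
  exact hp l List.prefix_rfl

theorem nil_mem_schrSet {a b k j : ℕ} : [] ∈ schrSet a b k j ↔ a = 0 ∧ b = 0 ∧ j = 0 := by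
  simp [schrSet, eq_comm]

theorem finite_schrSet (a b k j : ℕ) : (schrSet a b k j).Finite := by
  induction h : a + b using Nat.strong_induction_on generalizing a b j with
  | _ N ih =>
    subst h
    have hfin : ({[]} ∪ ⋃ s ∈ ({(1, 0), (0, 1), (1, 1)} : Set (ℕ × ℕ)),
        ⋃ a' ∈ Set.Iic a, ⋃ b' ∈ Set.Iic b, ⋃ j' ∈ Set.Iic j,
          (fun l => l ++ [s]) '' {l | a' + b' < a + b ∧ l ∈ schrSet a' b' k j'}).Finite := by
      refine (Set.finite_singleton _).union ?_
      refine Set.Finite.biUnion (Set.toFinite _) fun s _ => ?_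
      refine Set.Finite.biUnion (Set.finite_Iic _) fun a' _ => ?_
      refine Set.Finite.biUnion (Set.finite_Iic _) fun b' _ => ?_
      refine Set.Finite.biUnion (Set.finite_Iic _) fun j' _ => Set.Finite.image _ ?_
      by_cases hlt : a' + b' < a + b
      · exact (ih _ hlt a' b' j' rfl).subset fun l hl => hl.2
      · exact Set.finite_empty.subset fun l hl => hlt hl.1
    refine hfin.subset fun l hl => ?_
    rcases List.eq_nil_or_concat' l with rfl | ⟨l, s, rfl⟩
    · exact Or.inl rfl
    · rw [concat_mem_schrSet] at hl
      obtain ⟨hs, -, a', b', j', hl, h1, h2, h3⟩ := hl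
      right
      simp only [Set.mem_iUnion]
      refine ⟨s, hs, a', ?_, b', ?_, j', ?_, l, ⟨?_, hl⟩, rfl⟩
      · simp only [Set.mem_Iic]; omega
      · simp only [Set.mem_Iic]; omega
      · simp only [Set.mem_Iic]; omega
      · rcases hs with rfl | rfl | rfl <;> simp only at h1 h2 <;> omega

theorem schr_eq_zero_of_lt {a b k : ℕ} (j : ℕ) (h : b < k * a) : schr a b k j = 0 := by
  rw [schr_eq_ncard_schrSet, Set.ncard_eq_zero (finite_schrSet ..)]
  exact Set.eq_empty_of_forall_notMem fun l hl => (le_of_mem_schrSet hl).not_gt h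

theorem concat_injective (s : ℕ × ℕ) : Function.Injective fun l : List (ℕ × ℕ) => l ++ [s] :=
  fun _ _ h => List.append_cancel_right h

theorem schr_zero_left (b k j : ℕ) : schr 0 b k j = if j = 0 then 1 else 0 := by
  induction b with
  | zero =>
    have h : schrSet 0 0 k j = {l | l = [] ∧ j = 0} := by
      ext l
      rcases List.eq_nil_or_concat' l with rfl | ⟨l, s, rfl⟩
      · simp [nil_mem_schrSet]
      · simp only [concat_mem_schrSet, Set.mem_ofPred_eq, List.append_eq_nil_iff]
        constructor
        · rintro ⟨rfl | rfl | rfl, -, a', b', j', -, h1, h2, -⟩ <;> simp at h1 h2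
        · simp
    rw [schr_eq_ncard_schrSet, h]
    split_ifs with hj <;> simp [hj]
  | succ b ih =>
    have h : schrSet 0 (b + 1) k j = (fun l => l ++ [(0, 1)]) '' schrSet 0 b k j := by
      ext l
      rcases List.eq_nil_or_concat' l with rfl | ⟨l, s, rfl⟩
      · simp [nil_mem_schrSet]
      · simp only [concat_mem_schrSet, Set.mem_image]
        constructor
        · rintro ⟨rfl | rfl | rfl, -, a', b', j', hl, h1, h2, h3⟩
          · simp at h1
          · simp at h1 h2 h3
            subst h1 h2 h3
            exact ⟨l, hl, rfl⟩
          · simp at h1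
        · rintro ⟨l', hl', h⟩
          obtain ⟨rfl, h⟩ := List.append_inj' h rfl
          obtain rfl : (0, 1) = s := by simpa using h
          exact ⟨Or.inr (Or.inl rfl), by simp, 0, b, j, hl', by simp⟩
    rw [schr_eq_ncard_schrSet, h, Set.ncard_image_of_injective _ (concat_injective _),
      ← schr_eq_ncard_schrSet, ih]

theorem disjoint_image_concat {s t : ℕ × ℕ} (h : s ≠ t) (A B : Set (List (ℕ × ℕ))) :
    Disjoint ((fun l => l ++ [s]) '' A) ((fun l => l ++ [t]) '' B) := by
  rw [Set.disjoint_left]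
  rintro _ ⟨l, -, rfl⟩ ⟨l', -, h'⟩
  have := (List.append_inj' h' rfl).2
  simp only [List.cons.injEq, and_true] at this
  exact h this.symm

theorem concat_mem_image_concat {s t : ℕ × ℕ} {l : List (ℕ × ℕ)} {A : Set (List (ℕ × ℕ))} :
    l ++ [s] ∈ (fun l => l ++ [t]) '' A ↔ s = t ∧ l ∈ A := by
  constructor
  · rintro ⟨l', hl', h⟩
    obtain ⟨rfl, hts⟩ := List.append_inj' h rfl
    simp only [List.cons.injEq, and_true] at hts
    exact ⟨hts.symm, hl'⟩
  · rintro ⟨rfl, h⟩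
    exact ⟨l, h, rfl⟩

theorem schr_succ_succ_zero {a b k : ℕ} (h : k * (a + 1) ≤ b + 1) :
    schr (a + 1) (b + 1) k 0 = schr (a + 1) b k 0 + schr a b k 0 := by
  have hS : schrSet (a + 1) (b + 1) k 0 = (fun l => l ++ [(0, 1)]) '' schrSet (a + 1) b k 0 ∪
      (fun l => l ++ [(1, 1)]) '' schrSet a b k 0 := by
    ext l
    rcases List.eq_nil_or_concat' l with rfl | ⟨l, s, rfl⟩
    · simp [nil_mem_schrSet]
    · simp only [concat_mem_schrSet, Set.mem_union, concat_mem_image_concat, h, true_and]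
      constructor
      · rintro ⟨rfl | rfl | rfl, a', b', j', hl, h1, h2, h3⟩ <;> simp at h1 h2 h3
        · subst h1 h2 h3
          simpa using hl
        · subst h1 h2 h3
          simpa using hl
      · rintro (⟨rfl, hl⟩ | ⟨rfl, hl⟩)
        · exact ⟨by simp [IsStep], _, _, _, hl, by simp⟩
        · exact ⟨by simp [IsStep], _, _, _, hl, by simp⟩
  simp only [schr_eq_ncard_schrSet]
  rw [hS, Set.ncard_union_eq (disjoint_image_concat (by simp) _ _)
    ((finite_schrSet ..).image _) ((finite_schrSet ..).image _),
    Set.ncard_image_of_injective _ (concat_injective _),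
    Set.ncard_image_of_injective _ (concat_injective _)]

theorem schr_succ_succ_succ {a b k : ℕ} (j : ℕ) (h : k * (a + 1) ≤ b + 1) :
    schr (a + 1) (b + 1) k (j + 1) =
      schr a (b + 1) k j + schr (a + 1) b k (j + 1) + schr a b k (j + 1) := by
  have hS : schrSet (a + 1) (b + 1) k (j + 1) =
      (fun l => l ++ [(1, 0)]) '' schrSet a (b + 1) k j ∪
      (fun l => l ++ [(0, 1)]) '' schrSet (a + 1) b k (j + 1) ∪
      (fun l => l ++ [(1, 1)]) '' schrSet a b k (j + 1) := by
    ext l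
    rcases List.eq_nil_or_concat' l with rfl | ⟨l, s, rfl⟩
    · simp [nil_mem_schrSet]
    · simp only [concat_mem_schrSet, Set.mem_union, concat_mem_image_concat, h, true_and]
      constructor
      · rintro ⟨rfl | rfl | rfl, a', b', j', hl, h1, h2, h3⟩ <;> simp at h1 h2 h3 <;>
          subst h1 h2 h3 <;> simpa using hl
      · rintro ((⟨rfl, hl⟩ | ⟨rfl, hl⟩) | ⟨rfl, hl⟩) <;>
          exact ⟨by simp [IsStep], _, _, _, hl, by simp⟩
  simp only [schr_eq_ncard_schrSet]
  rw [hS, Set.ncard_union_eq _ (((finite_schrSet ..).image _).union ((finite_schrSet ..).image _))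
    ((finite_schrSet ..).image _), Set.ncard_union_eq (disjoint_image_concat (by simp) _ _)
    ((finite_schrSet ..).image _) ((finite_schrSet ..).image _),
    Set.ncard_image_of_injective _ (concat_injective _),
    Set.ncard_image_of_injective _ (concat_injective _),
    Set.ncard_image_of_injective _ (concat_injective _)]
  exact Set.disjoint_union_left.2
    ⟨disjoint_image_concat (by simp) _ _, disjoint_image_concat (by simp) _ _⟩

theorem cast_choose_succ_mul (n k : ℕ) :
    (n.choose (k + 1) : ℤ) * (k + 1) = n.choose k * (n - k) := by
  rcases le_or_gt k n with h | h
  · have := Nat.choose_succ_right_eq n k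
    zify [h] at this
    exact this
  · simp [Nat.choose_eq_zero_of_lt h, Nat.choose_eq_zero_of_lt (h.trans k.lt_succ_self)]

/-- The closed form, shifted so that it also covers the line just below the boundary. -/
theorem succ_mul_schr_two (n m j : ℕ) (hm : 2 * n + 1 ≤ m) :
    ((n + 1 : ℕ) : ℤ) * schr (n + 1) m 2 j =
      (m - 2 * n - 1) * (n + 1).choose j * (m + j).choose n := by
  induction n generalizing m j with
  | zero =>
    induction m, hm using Nat.le_induction with
    | base => simp [schr_eq_zero_of_lt]
    | succ m hm ih =>
      rcases j with _ | j
      · rw [schr_succ_succ_zero (by omega)]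
        simp [schr_zero_left] at ih ⊢
        linarith
      · rw [schr_succ_succ_succ j (by omega)]
        rcases j with _ | j <;> simp [schr_zero_left, Nat.choose_eq_zero_of_lt] at ih ⊢ <;> linarith
  | succ n ihn =>
    induction m, hm using Nat.le_induction with
    | base =>
      rw [schr_eq_zero_of_lt _ (by omega)]
      push_cast
      ring
    | succ m hm ih =>
      have hn : ((n + 1 : ℕ) : ℤ) ≠ 0 := by positivity
      refine mul_left_cancel₀ hn ?_
      rcases j with _ | j
      · have h1 := ihn m 0 (by omega)
        rw [schr_succ_succ_zero (by omega)]
        have h2 := cast_choose_succ_mul m n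
        simp only [Nat.choose_zero_right, Nat.add_zero, Nat.choose_succ_succ'] at ih h1 ⊢
        push_cast at ih h1 h2 ⊢
        linear_combination (n + 1 : ℤ) * ih + (n + 2 : ℤ) * h1 - h2
      · have h1 := ihn m (j + 1) (by omega)
        have h0 := ihn (m + 1) j (by omega)
        rw [schr_succ_succ_succ j (by omega)]
        have h2 := cast_choose_succ_mul (m + (j + 1)) n
        have h3 := cast_choose_succ_mul (n + 1) j
        rw [show m + 1 + j = m + (j + 1) by ring] at h0
        rw [show m + 1 + (j + 1) = m + (j + 1) + 1 by ring, Nat.choose_succ_succ' _ n]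
        rw [Nat.choose_succ_succ' (n + 1)] at ih ⊢
        push_cast at ih h0 h1 h2 h3 ⊢
        linear_combination (n + 1 : ℤ) * ih + (n + 2 : ℤ) * h1 + (n + 2 : ℤ) * h0 -
          ((n + 1).choose j + (n + 1).choose (j + 1) : ℤ) * h2 -
          ((m + (j + 1)).choose n : ℤ) * h3

theorem stmt4 (n j m : ℕ) (hn : 1 ≤ n) (hj : j ≤ n) (hm : 2 * n ≤ m) :
    n * schr n m 2 j = (m - 2 * n + 1) * n.choose j * (m + j).choose (n - 1) := by
  obtain ⟨n, rfl⟩ := Nat.exists_eq_add_of_le' hn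
  have h := succ_mul_schr_two n m j (by omega)
  zify [hm]
  rw [Nat.add_sub_cancel]
  push_cast at h ⊢
  rw [h]
  ring
end

section
/- For all non-negative integers n and j with j ≤ n, the number T(n,j) = binom(2n+j,j)*binom(2n+1,n+j+1)/(2n+1) is an integer, i.e., 2n+1 divides binom(2n+j,j)*binom(2n+1,n+j+1). Moreover, if n ≥ 1, then n * binom(2n+j,j) * binom(2n+1,n+j+1) = (2n+1) * binom(n,j) * binom(2n+j,n-1), so that T(n,j) = binom(n,j)*binom(2n+j,n-1)/n. -/
/-- Absorption form of the identity between the two binomial expressions for `T(n, j)`. -/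
theorem mul_choose_mul_choose_eq {n j : ℕ} (hj : j ≤ n) (hn : 1 ≤ n) :
    n * ((2 * n + j).choose j * (2 * n + 1).choose (n + j + 1)) =
      (2 * n + 1) * (n.choose j * (2 * n + j).choose (n - 1)) := by
  have hfac : (n.factorial : ℚ) = n * (n - 1).factorial := by
    exact_mod_cast (Nat.mul_factorial_pred (by lia)).symm
  have hsucc : ((2 * n + 1).factorial : ℚ) = (2 * n + 1) * (2 * n).factorial := by
    exact_mod_cast Nat.factorial_succ (2 * n)
  qify
  rw [Nat.cast_choose ℚ (show j ≤ 2 * n + j by lia),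
    Nat.cast_choose ℚ (show n + j + 1 ≤ 2 * n + 1 by lia), Nat.cast_choose ℚ hj,
    Nat.cast_choose ℚ (show n - 1 ≤ 2 * n + j by lia),
    show 2 * n + j - j = 2 * n by lia, show 2 * n + 1 - (n + j + 1) = n - j by lia,
    show 2 * n + j - (n - 1) = n + j + 1 by lia, hfac, hsucc]
  field_simp

theorem stmt6 (n j : ℕ) (hj : j ≤ n) :
    (2 * n + 1) ∣ (2 * n + j).choose j * (2 * n + 1).choose (n + j + 1) ∧
      (1 ≤ n →
        n * ((2 * n + j).choose j * (2 * n + 1).choose (n + j + 1)) =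
          (2 * n + 1) * (n.choose j * (2 * n + j).choose (n - 1))) := by
  refine ⟨?_, mul_choose_mul_choose_eq hj⟩
  obtain rfl | hn := Nat.eq_zero_or_pos n
  · simp
  · have hcop : (2 * n + 1).Coprime n := by simp
    exact hcop.dvd_of_dvd_mul_left ⟨_, mul_choose_mul_choose_eq hj hn⟩
end

section
/- For every non-negative integer n, the product (n+1)*(2n+1) divides 2*binom(3n,n); that is, 2*binom(3n,n)/((n+1)*(2n+1)) is an integer. -/
theorem two_mul_add_one_dvd_choose (n : ℕ) : 2 * n + 1 ∣ (3 * n).choose n := by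
  have hcop : Nat.Coprime (2 * n + 1) (3 * n + 1) := by
    rw [← Nat.isCoprime_iff_coprime]
    exact ⟨3, -2, by push_cast; ring⟩
  have hsymm : (3 * n).choose (2 * n) = (3 * n).choose n :=
    Nat.choose_symm_of_eq_add (by ring)
  refine hcop.dvd_of_dvd_mul_left ⟨(3 * n + 1).choose (2 * n + 1), ?_⟩
  rw [← hsymm, Nat.add_one_mul_choose_eq, mul_comm]

theorem add_one_dvd_two_mul_choose (n : ℕ) : n + 1 ∣ 2 * (3 * n).choose n := by
  have hcop : Nat.Coprime (n + 1) n := by simp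
  refine hcop.dvd_of_dvd_mul_left ⟨(3 * n).choose (n + 1), ?_⟩
  have h := Nat.choose_succ_right_eq (3 * n) n
  rw [show 3 * n - n = 2 * n by omega] at h
  linarith

theorem stmt7 (n : ℕ) : (n + 1) * (2 * n + 1) ∣ 2 * (3 * n).choose n := by
  have hcop : Nat.Coprime (n + 1) (2 * n + 1) := by
    rw [← Nat.isCoprime_iff_coprime]
    exact ⟨2, -1, by push_cast; ring⟩
  exact hcop.mul_dvd_of_dvd_of_dvd (add_one_dvd_two_mul_choose n)
    ((two_mul_add_one_dvd_choose n).mul_left 2)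
end

section
/- For all non-negative integers n and t, the number 2n+1 divides binom(3n,n+t) * binom(2n+t,2n). -/
theorem stmt9 (n t : ℕ) :
    (2 * n + 1) ∣ (3 * n).choose (n + t) * (2 * n + t).choose (2 * n) := by
  rcases lt_or_ge (2 * n) t with ht | ht
  · simp [Nat.choose_eq_zero_of_lt (show 3 * n < n + t by omega)]
  have hcop : IsCoprime ((2 * n + 1 : ℕ) : ℤ) ((3 * n + 1 : ℕ) : ℤ) :=
    ⟨3, -2, by push_cast; ring⟩
  have h₁ := Nat.choose_mul_succ_eq (3 * n) (n + t)
  have h₂ := Nat.choose_succ_right_eq (2 * n + t) (2 * n)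
  rw [Nat.add_sub_cancel_left] at h₂
  zify [show n + t ≤ 3 * n + 1 by omega] at h₁
  zify at h₂
  rw [← Int.natCast_dvd_natCast]
  refine hcop.dvd_of_dvd_mul_right
    ⟨(3 * n + 1).choose (n + t) *
      ((2 * n + t).choose (2 * n) - (2 * n + t).choose (2 * n + 1)), ?_⟩
  push_cast
  linear_combination ((2 * n + t).choose (2 * n) : ℤ) * h₁ +
    ((3 * n + 1).choose (n + t) : ℤ) * h₂
end

section
/- For all non-negative integers n and t, the number 2n+1 divides binom(3n+1,n+t+1) * binom(2n+t,2n). -/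
theorem stmt10 (n t : ℕ) :
    (2 * n + 1) ∣ (3 * n + 1).choose (n + t + 1) * (2 * n + t).choose (2 * n) := by
  have hB : 2 * n + 1 ∣ (2 * n + t).choose (2 * n) * t := by
    have h := Nat.choose_succ_right_eq (2 * n + t) (2 * n)
    rw [Nat.add_sub_cancel_left] at h
    exact h ▸ dvd_mul_left _ _
  have hA : Nat.gcd (2 * n + 1) t ∣ (3 * n + 1).choose (n + t + 1) := by
    have h := Nat.choose_succ_right_eq (3 * n + 1) (n + t)
    rw [show 3 * n + 1 - (n + t) = 2 * n + 1 - t by omega] at h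
    have hdvd : Nat.gcd (2 * n + 1) t ∣ (3 * n + 1).choose (n + t + 1) * (n + t + 1) :=
      h ▸ dvd_mul_of_dvd_right (Nat.dvd_sub (Nat.gcd_dvd_left _ _) (Nat.gcd_dvd_right _ _)) _
    refine Nat.Coprime.dvd_of_dvd_mul_right ?_ hdvd
    refine Nat.eq_one_of_dvd_one ?_
    set d := Nat.gcd (Nat.gcd (2 * n + 1) t) (n + t + 1)
    have hd : d ∣ Nat.gcd (2 * n + 1) t := Nat.gcd_dvd_left _ _
    have hN : d ∣ 2 * n + 1 := hd.trans (Nat.gcd_dvd_left _ _)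
    have ht : d ∣ t := hd.trans (Nat.gcd_dvd_right _ _)
    have hk : d ∣ n + t + 1 := Nat.gcd_dvd_right _ _
    have hsub := Nat.dvd_sub (hk.mul_left 2) (dvd_add hN (ht.mul_left 2))
    rwa [show 2 * (n + t + 1) - (2 * n + 1 + 2 * t) = 1 by omega] at hsub
  calc 2 * n + 1 ∣ Nat.gcd ((2 * n + t).choose (2 * n) * (2 * n + 1))
        ((2 * n + t).choose (2 * n) * t) := Nat.dvd_gcd (dvd_mul_left _ _) hB
    _ = Nat.gcd (2 * n + 1) t * (2 * n + t).choose (2 * n) := by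
        rw [Nat.gcd_mul_left, mul_comm]
    _ ∣ _ := Nat.mul_dvd_mul_right hA _
end

section
/- For all non-negative integers n and t, the number 2n+1 divides binom(3n,n+t+1) * binom(2n+t,2n). -/
theorem le_mod_add_mod_of_dvd {q k l : ℕ} (hq : 3 ≤ q) (hk : q ∣ 2 * k + q - 1)
    (hl : q ∣ l + 2) : q ≤ k % q + l % q := by
  have hkm := Nat.mod_add_div k q
  have hlm := Nat.mod_add_div l q
  have hk_lt := Nat.mod_lt k (show q > 0 by omega)
  have hl_lt := Nat.mod_lt l (show q > 0 by omega)
  have hl' : q ∣ l % q + 2 := by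
    rw [← hlm] at hl
    exact (Nat.dvd_add_left (Dvd.intro (l / q) rfl)).1 (by convert hl using 1; ring)
  have hk' : q ∣ 2 * (k % q) + q - 1 := by
    refine (Nat.dvd_add_left (Dvd.intro (2 * (k / q)) rfl)).1
      (show q ∣ 2 * (k % q) + q - 1 + q * (2 * (k / q)) from ?_)
    convert hk using 1
    have : q * (2 * (k / q)) = 2 * (q * (k / q)) := by ring
    omega
  have hl_ge := Nat.le_of_dvd (by omega) hl'
  obtain ⟨c, hc⟩ := hk'
  have hc_pos : 2 ≤ c ∨ c = 1 ∨ c = 0 := by omega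
  rcases hc_pos with hc2 | rfl | rfl
  · have := Nat.mul_le_mul_left q hc2
    omega
  · omega
  · omega

theorem prime_pow_dvd_choose_three_mul {n t p a : ℕ} (hp : p.Prime) (hn : p ^ a ∣ 2 * n + 1)
    (ht : p ^ a ∣ t) : p ^ a ∣ (3 * n).choose (n + t + 1) := by
  rcases lt_or_ge (3 * n) (n + t + 1) with h | h
  · rw [Nat.choose_eq_zero_of_lt h]
    exact dvd_zero _
  have := Fact.mk hp
  rw [padicValNat_dvd_iff_le (Nat.choose_pos h).ne',
    padicValNat_choose h (show Nat.log p (3 * n) < Nat.log p (3 * n) + a + 1 by omega)]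
  calc a = (Finset.Ico 1 (a + 1)).card := by simp
    _ ≤ _ := Finset.card_le_card fun i hi => ?_
  simp only [Finset.mem_Ico, Finset.mem_filter] at hi ⊢
  refine ⟨by omega, ?_⟩
  have hin : p ^ i ∣ 2 * n + 1 := (pow_dvd_pow p (by omega)).trans hn
  have hit : p ^ i ∣ t := (pow_dvd_pow p (by omega)).trans ht
  have hi1 : 1 < p ^ i := Nat.one_lt_pow (by omega) hp.one_lt
  have hi2 : p ^ i ≠ 2 := fun h2 => by
    rw [h2] at hin
    omega
  apply le_mod_add_mod_of_dvd (by omega)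
  · rw [show 2 * (n + t + 1) + p ^ i - 1 = 2 * n + 1 + 2 * t + p ^ i by omega]
    exact (hin.add (hit.mul_left 2)).add (dvd_refl _)
  · refine (Nat.dvd_add_left hit).1 ?_
    convert hin using 1
    omega

theorem gcd_dvd_choose_three_mul (n t : ℕ) :
    (2 * n + 1).gcd t ∣ (3 * n).choose (n + t + 1) :=
  (Nat.dvd_iff_prime_pow_dvd_dvd _ _).2 fun _ _ hp h =>
    prime_pow_dvd_choose_three_mul hp (h.trans (Nat.gcd_dvd_left _ _))
      (h.trans (Nat.gcd_dvd_right _ _))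

theorem succ_dvd_gcd_mul_choose (m t : ℕ) : m + 1 ∣ (m + 1).gcd t * (m + t).choose m := by
  rw [← Nat.gcd_mul_right]
  refine Nat.dvd_gcd (dvd_mul_right _ _) ⟨(m + t).choose (m + 1), ?_⟩
  have := Nat.choose_succ_right_eq (m + t) m
  rw [Nat.add_sub_cancel_left] at this
  linarith

theorem stmt11 (n t : ℕ) :
    (2 * n + 1) ∣ (3 * n).choose (n + t + 1) * (2 * n + t).choose (2 * n) := by
  exact (succ_dvd_gcd_mul_choose (2 * n) t).trans
    (Nat.mul_dvd_mul_right (gcd_dvd_choose_three_mul n t) _)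
end
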